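/- Let μ be a probability measure on U(d), t ≥ 1, and ε ≥ 0, and suppose μ is an ε-approximate unitary t-design, i.e., for every d^t×d^t matrix X, ‖∫ U^{⊗t} X (U^†)^{⊗t} dμ(U) − ∫ U^{⊗t} X (U^†)^{⊗t} dμ_H(U)‖_2 ≤ ε ‖X‖_2. Then for every real ν ≥ 0, μ({U ∈ U(d) : max_{i,j∈[d]} |U_{i,j}|² ≥ 2^{−ν}}) ≤ d² · 2^{νt} · (d^{−t} t! + d^{2t} ε). Equivalently, μ({U : C(U) ≤ ν}) is at most that quantity, where C(U) := −log₂ max_{i,j} |U_{i,j}|². -/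

import Mathlib

open MeasureTheory
open scoped BigOperators Matrix

/-- Borel measurable-space structure on the unitary group `U(d)`. -/
noncomputable instance unitaryGroup.measurableSpace (d : ℕ) :
    MeasurableSpace (Matrix.unitaryGroup (Fin d) ℂ) := borel _

instance unitaryGroup.borelSpace (d : ℕ) :
    BorelSpace (Matrix.unitaryGroup (Fin d) ℂ) := ⟨rfl⟩

/-- The `t`-fold Kronecker (tensor) power of a `d×d` matrix, indexed by tuples. -/
def tensorPow {d : ℕ} (t : ℕ) (A : Matrix (Fin d) (Fin d) ℂ) :
    Matrix (Fin t → Fin d) (Fin t → Fin d) ℂ :=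
  fun x y => ∏ a : Fin t, A (x a) (y a)

/-- The Frobenius (Hilbert-Schmidt) norm of a matrix. -/
noncomputable def frobNorm {α : Type*} [Fintype α] (M : Matrix α α ℂ) : ℝ :=
  Real.sqrt (∑ x : α, ∑ y : α, ‖M x y‖ ^ 2)

/-- The `t`-th moment superoperator of a measure `ν` on `U(d)`, defined entrywise. -/
noncomputable def momentSuper (d t : ℕ) (ν : Measure (Matrix.unitaryGroup (Fin d) ℂ))
    (X : Matrix (Fin t → Fin d) (Fin t → Fin d) ℂ) :
    Matrix (Fin t → Fin d) (Fin t → Fin d) ℂ :=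
  fun x y =>
    ∫ U : Matrix.unitaryGroup (Fin d) ℂ,
      (tensorPow t (U : Matrix (Fin d) (Fin d) ℂ) * X *
        (tensorPow t (U : Matrix (Fin d) (Fin d) ℂ))ᴴ) x y ∂ν

theorem taylor_aux (n : ℕ) : ∃ C : ℝ, 0 ≤ C ∧ ∀ A x B s : ℝ, |A| ≤ 1 → |x| ≤ 2 → |B| ≤ 1 →
    0 ≤ s → s ≤ 1 →
    |(A + (s * x + s ^ 2 * B)) ^ (n + 2) - (A ^ (n + 2) + (n + 2) * A ^ (n + 1) * (s * x + s ^ 2 * B)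
      + (n + 2) * (n + 1) / 2 * A ^ n * x ^ 2 * s ^ 2)| ≤ C * s ^ 3 := by
  induction n with
  | zero =>
    refine ⟨5, by norm_num, ?_⟩
    intro A x B s hA hx hB hs hs1
    have e : (A + (s * x + s ^ 2 * B)) ^ (0 + 2) - (A ^ (0 + 2) + (((0 : ℕ) : ℝ) + 2) * A ^ (0 + 1) * (s * x + s ^ 2 * B)
      + (((0 : ℕ) : ℝ) + 2) * (((0 : ℕ) : ℝ) + 1) / 2 * A ^ 0 * x ^ 2 * s ^ 2) = (2 * x * B + s * B ^ 2) * s ^ 3 := by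
      push_cast; ring
    rw [e, abs_mul, abs_of_nonneg (pow_nonneg hs 3)]
    gcongr
    calc |2 * x * B + s * B ^ 2| ≤ |2 * x * B| + |s * B ^ 2| := abs_add_le _ _
      _ = 2 * |x| * |B| + s * |B| ^ 2 := by
        rw [abs_mul, abs_mul, abs_mul, abs_pow, abs_of_nonneg hs]; norm_num
      _ ≤ 2 * 2 * 1 + 1 * 1 ^ 2 := by gcongr
      _ = 5 := by norm_num
  | succ n ih =>
    obtain ⟨C, hC, h⟩ := ih
    refine ⟨4 * C + ((n + 2) * 5 + (n + 2) * (n + 1) / 2 * 2 ^ 2 * 3), by positivity, ?_⟩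
    intro A x B s hA hx hB hs hs1
    have h0 := h A x B s hA hx hB hs hs1
    have hy : |x + s * B| ≤ 3 := by
      calc |x + s * B| ≤ |x| + |s * B| := abs_add_le _ _
        _ = |x| + s * |B| := by rw [abs_mul, abs_of_nonneg hs]
        _ ≤ 2 + 1 * 1 := by gcongr
        _ = 3 := by norm_num
    have hAy : |A + (s * x + s ^ 2 * B)| ≤ 4 := by
      calc |A + (s * x + s ^ 2 * B)| = |A + s * (x + s * B)| := by ring_nf
        _ ≤ |A| + |s * (x + s * B)| := abs_add_le _ _
        _ = |A| + s * |x + s * B| := by rw [abs_mul, abs_of_nonneg hs]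
        _ ≤ 1 + 1 * 3 := by gcongr
        _ = 4 := by norm_num
    have h5 : |2 * x * B + s * B ^ 2| ≤ 5 := by
      calc |2 * x * B + s * B ^ 2| ≤ |2 * x * B| + |s * B ^ 2| := abs_add_le _ _
        _ = 2 * |x| * |B| + s * |B| ^ 2 := by
          rw [abs_mul, abs_mul, abs_mul, abs_pow, abs_of_nonneg hs]; norm_num
        _ ≤ 2 * 2 * 1 + 1 * 1 ^ 2 := by gcongr
        _ = 5 := by norm_num
    set E := (A + (s * x + s ^ 2 * B)) ^ (n + 2) - (A ^ (n + 2) + (n + 2) * A ^ (n + 1) * (s * x + s ^ 2 * B)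
      + (n + 2) * (n + 1) / 2 * A ^ n * x ^ 2 * s ^ 2) with hE
    have e : (A + (s * x + s ^ 2 * B)) ^ (n + 1 + 2) - (A ^ (n + 1 + 2) + (((n + 1 : ℕ) : ℝ) + 2) * A ^ (n + 1 + 1) * (s * x + s ^ 2 * B)
      + (((n + 1 : ℕ) : ℝ) + 2) * (((n + 1 : ℕ) : ℝ) + 1) / 2 * A ^ (n + 1) * x ^ 2 * s ^ 2)
      = (A + (s * x + s ^ 2 * B)) * E + ((n + 2) * A ^ (n + 1) * (2 * x * B + s * B ^ 2)
        + (n + 2) * (n + 1) / 2 * A ^ n * x ^ 2 * (x + s * B)) * s ^ 3 := by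
      rw [hE]; push_cast; ring
    rw [e]
    have hn2 : (0 : ℝ) ≤ (n + 2) * (n + 1) / 2 := by positivity
    have hn1 : (0 : ℝ) ≤ (n : ℝ) + 2 := by positivity
    have hA1 : |A| ^ (n + 1) ≤ 1 := pow_le_one₀ (abs_nonneg _) hA
    have hA0 : |A| ^ n ≤ 1 := pow_le_one₀ (abs_nonneg _) hA
    calc _ ≤ |(A + (s * x + s ^ 2 * B)) * E| + |((n + 2) * A ^ (n + 1) * (2 * x * B + s * B ^ 2)
        + (n + 2) * (n + 1) / 2 * A ^ n * x ^ 2 * (x + s * B)) * s ^ 3| := abs_add_le _ _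
      _ = |A + (s * x + s ^ 2 * B)| * |E| + |(n + 2) * A ^ (n + 1) * (2 * x * B + s * B ^ 2)
        + (n + 2) * (n + 1) / 2 * A ^ n * x ^ 2 * (x + s * B)| * s ^ 3 := by
        rw [abs_mul, abs_mul _ (s ^ 3), abs_of_nonneg (pow_nonneg hs 3)]
      _ ≤ 4 * (C * s ^ 3) + ((n + 2) * 1 * 5 + (n + 2) * (n + 1) / 2 * 1 * 2 ^ 2 * 3) * s ^ 3 := by
        gcongr
        refine (abs_add_le _ _).trans ?_
        rw [abs_mul, abs_mul, abs_mul (_ * _) (x + s * B), abs_mul (_ * _) (x ^ 2),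
          abs_mul (_ / _) (A ^ n), abs_pow, abs_pow, abs_pow,
          abs_of_nonneg hn2, abs_of_nonneg hn1]
        gcongr
      _ = _ := by ring

/-- averaged version over the four phases -/
theorem four_aux (n : ℕ) : ∃ C : ℝ, 0 ≤ C ∧ ∀ (a b : ℂ) (s : ℝ), ‖a‖ ≤ 1 → ‖b‖ ≤ 1 →
    0 ≤ s → s ≤ 1 →
    (‖a + s * 1 * b‖ ^ 2) ^ (n + 1) + (‖a + s * (-1) * b‖ ^ 2) ^ (n + 1)
     + (‖a + s * Complex.I * b‖ ^ 2) ^ (n + 1) + (‖a + s * (-Complex.I) * b‖ ^ 2) ^ (n + 1)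
     ≤ 4 * (‖a‖ ^ 2) ^ (n + 1) + 4 * (n + 1) ^ 2 * s ^ 2 * ((‖a‖ ^ 2) ^ n * ‖b‖ ^ 2) + C * s ^ 3 := by
  have key : ∀ (a b : ℂ) (s : ℝ), 
      ‖a + s * 1 * b‖ ^ 2 = ‖a‖ ^ 2 + (s * (2 * (a.re * b.re + a.im * b.im)) + s ^ 2 * ‖b‖ ^ 2) ∧
      ‖a + s * (-1) * b‖ ^ 2 = ‖a‖ ^ 2 + (s * (-(2 * (a.re * b.re + a.im * b.im))) + s ^ 2 * ‖b‖ ^ 2) ∧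
      ‖a + s * Complex.I * b‖ ^ 2 = ‖a‖ ^ 2 + (s * (2 * (a.im * b.re - a.re * b.im)) + s ^ 2 * ‖b‖ ^ 2) ∧
      ‖a + s * (-Complex.I) * b‖ ^ 2 = ‖a‖ ^ 2 + (s * (-(2 * (a.im * b.re - a.re * b.im))) + s ^ 2 * ‖b‖ ^ 2) := by
    intro a b s
    simp only [← Complex.normSq_eq_norm_sq, Complex.normSq_apply]
    refine ⟨?_, ?_, ?_, ?_⟩ <;> simp <;> ring
  have hsq : ∀ a b : ℂ, (2 * (a.re * b.re + a.im * b.im)) ^ 2 + (2 * (a.im * b.re - a.re * b.im)) ^ 2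
      = 4 * (‖a‖ ^ 2 * ‖b‖ ^ 2) := by
    intro a b
    simp only [← Complex.normSq_eq_norm_sq, Complex.normSq_apply]; ring
  rcases n with _ | n
  · refine ⟨0, le_rfl, ?_⟩
    intro a b s ha hb hs hs1
    obtain ⟨h1, h2, h3, h4⟩ := key a b s
    rw [h1, h2, h3, h4]
    apply le_of_eq; push_cast; ring
  · obtain ⟨C, hC, h⟩ := taylor_aux n
    refine ⟨4 * C, by positivity, ?_⟩
    intro a b s ha hb hs hs1
    obtain ⟨h1, h2, h3, h4⟩ := key a b s
    rw [h1, h2, h3, h4]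
    have hA : ‖a‖ ^ 2 ≤ 1 := pow_le_one₀ (norm_nonneg _) ha
    have hB : ‖b‖ ^ 2 ≤ 1 := pow_le_one₀ (norm_nonneg _) hb
    have hA' : |‖a‖ ^ 2| ≤ 1 := by rwa [abs_of_nonneg (by positivity)]
    have hB' : |‖b‖ ^ 2| ≤ 1 := by rwa [abs_of_nonneg (by positivity)]
    have hs2 := hsq a b
    have hAB : ‖a‖ ^ 2 * ‖b‖ ^ 2 ≤ 1 := mul_le_one₀ hA (by positivity) hB
    have hx : |2 * (a.re * b.re + a.im * b.im)| ≤ 2 := by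
      apply abs_le_of_sq_le_sq _ (by norm_num)
      nlinarith [sq_nonneg (2 * (a.im * b.re - a.re * b.im))]
    have hz : |2 * (a.im * b.re - a.re * b.im)| ≤ 2 := by
      apply abs_le_of_sq_le_sq _ (by norm_num)
      nlinarith [sq_nonneg (2 * (a.re * b.re + a.im * b.im))]
    generalize 2 * (a.re * b.re + a.im * b.im) = x at *
    generalize 2 * (a.im * b.re - a.re * b.im) = z at *
    generalize ‖a‖ ^ 2 = A at *
    generalize ‖b‖ ^ 2 = B at *
    have k1 := (abs_le.1 (h A x B s hA' hx hB' hs hs1)).2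
    have k2 := (abs_le.1 (h A (-x) B s hA' (by rwa [abs_neg]) hB' hs hs1)).2
    have k3 := (abs_le.1 (h A z B s hA' hz hB' hs hs1)).2
    have k4 := (abs_le.1 (h A (-z) B s hA' (by rwa [abs_neg]) hB' hs hs1)).2
    have e : (n + 2 : ℝ) * (n + 1) / 2 * A ^ n * x ^ 2 * s ^ 2 + (n + 2 : ℝ) * (n + 1) / 2 * A ^ n * z ^ 2 * s ^ 2
        = (n + 2 : ℝ) * (n + 1) / 2 * A ^ n * (4 * (A * B)) * s ^ 2 := by rw [← hs2]; ring
    push_cast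
    have e2 : 4 * ((n : ℝ) + 1 + 1) ^ 2 * s ^ 2 * (A ^ (n + 1) * B) =
      4 * ((n + 2) * A ^ (n + 1) * (s ^ 2 * B)) + 2 * ((n + 2 : ℝ) * (n + 1) / 2 * A ^ n * (4 * (A * B)) * s ^ 2) := by ring
    rw [e2, ← e]
    simp only [show n + 1 + 1 = n + 2 from rfl]
    nlinarith [k1, k2, k3, k4]

theorem cont_entry {d : ℕ} (i j : Fin d) :
    Continuous fun U : Matrix.unitaryGroup (Fin d) ℂ => (U : Matrix (Fin d) (Fin d) ℂ) i j :=
  (continuous_subtype_val).matrix_elem i j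

theorem entry_le {d : ℕ} (U : Matrix.unitaryGroup (Fin d) ℂ) (i j : Fin d) :
    ‖(U : Matrix (Fin d) (Fin d) ℂ) i j‖ ≤ 1 := entry_norm_bound_of_unitary U.2 i j

theorem unitary_rot {d : ℕ} (p q : Fin d) (hpq : p ≠ q) (w : ℂ) (hw : ‖w‖ = 1) (s : ℝ) :
    ∃ V : Matrix.unitaryGroup (Fin d) ℂ, ∀ (U : Matrix.unitaryGroup (Fin d) ℂ) (j : Fin d),
      (1 + s ^ 2) * ‖((V * U : Matrix.unitaryGroup (Fin d) ℂ) : Matrix (Fin d) (Fin d) ℂ) p j‖ ^ 2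
        = ‖(U : Matrix (Fin d) (Fin d) ℂ) p j + s * w * (U : Matrix (Fin d) (Fin d) ℂ) q j‖ ^ 2 := by
  set φ : ℝ := Real.arctan s / 2 with hφ
  have hww : star w * w = 1 := by
    have := Complex.conj_mul' w
    rw [hw] at this; simpa using this
  let u : Fin d → ℂ := Pi.single p (Real.sin φ : ℂ) + Pi.single q (-(Real.cos φ : ℂ) * star w)
  have hdot : ∀ z : Fin d → ℂ, star u ⬝ᵥ z = (Real.sin φ : ℂ) * z p - (Real.cos φ : ℂ) * w * z q := by
    intro z
    have : star u = Pi.single p (Real.sin φ : ℂ) + Pi.single q (-(Real.cos φ : ℂ) * w) := by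
      simp only [u, star_add, ← Pi.single_star, star_mul', star_neg, RCLike.star_def, Complex.conj_ofReal, Complex.conj_conj]
    rw [this, add_dotProduct, single_dotProduct, single_dotProduct]; ring
  have hup : u p = (Real.sin φ : ℂ) := by simp [u, hpq]
  have huq : u q = -(Real.cos φ : ℂ) * star w := by simp [u, hpq.symm]
  have huu : star u ⬝ᵥ u = 1 := by
    rw [hdot, hup, huq]
    have : (Real.sin φ : ℂ) ^ 2 + (Real.cos φ : ℂ) ^ 2 = 1 := by
      exact_mod_cast Real.sin_sq_add_cos_sq φ
    linear_combination this + (Real.cos φ : ℂ) ^ 2 * hww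
  let M : Matrix (Fin d) (Fin d) ℂ := 1 - (2 : ℂ) • Matrix.vecMulVec u (star u)
  have hP : Matrix.vecMulVec u (star u) * Matrix.vecMulVec u (star u) = Matrix.vecMulVec u (star u) := by
    rw [Matrix.vecMulVec_mul_vecMulVec, huu, one_smul]
  have hPs : star (Matrix.vecMulVec u (star u)) = Matrix.vecMulVec u (star u) := by
    rw [Matrix.star_eq_conjTranspose, Matrix.conjTranspose_vecMulVec, star_star]
  have hMs : star M = M := by
    simp only [M, star_sub, star_one, star_smul, hPs]; simp
  have hM : M ∈ Matrix.unitaryGroup (Fin d) ℂ := by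
    rw [Matrix.mem_unitaryGroup_iff, hMs]
    simp only [M, sub_mul, mul_sub, one_mul, mul_one, smul_mul_assoc, mul_smul_comm, hP]
    module
  refine ⟨⟨M, hM⟩, ?_⟩
  intro U j
  have hent : (((⟨M, hM⟩ : Matrix.unitaryGroup (Fin d) ℂ) * U : Matrix.unitaryGroup (Fin d) ℂ) : Matrix (Fin d) (Fin d) ℂ) p j
     = (Real.cos (Real.arctan s) : ℂ) * ((U : Matrix (Fin d) (Fin d) ℂ) p j + s * w * (U : Matrix (Fin d) (Fin d) ℂ) q j) := by
    have h1 : (M * (U : Matrix (Fin d) (Fin d) ℂ)) p j = (U : Matrix (Fin d) (Fin d) ℂ) p j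
        - 2 * (u p * (star u ⬝ᵥ fun k => (U : Matrix (Fin d) (Fin d) ℂ) k j)) := by
      simp only [M, sub_mul, one_mul, smul_mul_assoc, Matrix.sub_apply, Matrix.smul_apply, smul_eq_mul]
      congr 2
      simp only [Matrix.mul_apply, Matrix.vecMulVec_apply, dotProduct, Finset.mul_sum, mul_assoc]
    have hc : Real.cos (Real.arctan s) = 1 - 2 * Real.sin φ ^ 2 := by
      have : Real.arctan s = 2 * φ := by rw [hφ]; ring
      rw [this, Real.cos_two_mul, Real.cos_sq']; ring
    have hs : Real.cos (Real.arctan s) * s = 2 * Real.sin φ * Real.cos φ := by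
      have : Real.arctan s = 2 * φ := by rw [hφ]; ring
      rw [← Real.sin_two_mul, ← this]
      conv_lhs => rw [← Real.tan_arctan s, Real.arctan_tan (Real.neg_pi_div_two_lt_arctan s) (Real.arctan_lt_pi_div_two s)]
      rw [mul_comm, Real.tan_mul_cos (Real.cos_arctan_pos s).ne']
    have hc' : (Real.cos (Real.arctan s) : ℂ) = 1 - 2 * (Real.sin φ : ℂ) ^ 2 := by
      rw [hc]; push_cast; ring
    have hs' : (Real.cos (Real.arctan s) : ℂ) * s = 2 * (Real.sin φ : ℂ) * (Real.cos φ : ℂ) := by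
      exact_mod_cast hs
    change (M * (U : Matrix (Fin d) (Fin d) ℂ)) p j = _
    rw [h1, hdot, hup]
    linear_combination -(U : Matrix (Fin d) (Fin d) ℂ) p j * hc' - w * (U : Matrix (Fin d) (Fin d) ℂ) q j * hs'
  rw [hent, norm_mul, mul_pow, Complex.norm_real, Real.norm_eq_abs, sq_abs, Real.cos_sq_arctan]
  have : (1 + s ^ 2) ≠ 0 := by positivity
  field_simp

theorem integrable_bdd {d : ℕ} (ρ : Measure (Matrix.unitaryGroup (Fin d) ℂ)) [IsProbabilityMeasure ρ]
    (f : Matrix.unitaryGroup (Fin d) ℂ → ℝ) (hf : Continuous f) (C : ℝ) (hC : ∀ U, |f U| ≤ C) :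
    Integrable f ρ :=
  Integrable.of_bound (hf.measurable.aestronglyMeasurable) C (Filter.Eventually.of_forall hC)

theorem haar_rot {d : ℕ} (μH : Measure (Matrix.unitaryGroup (Fin d) ℂ)) [μH.IsHaarMeasure]
    (p q j : Fin d) (hpq : p ≠ q) (w : ℂ) (hw : ‖w‖ = 1) (s : ℝ) (n : ℕ) :
    ∫ U, (‖(U : Matrix (Fin d) (Fin d) ℂ) p j + s * w * (U : Matrix (Fin d) (Fin d) ℂ) q j‖ ^ 2) ^ n ∂μH
      = (1 + s ^ 2) ^ n * ∫ U, (‖(U : Matrix (Fin d) (Fin d) ℂ) p j‖ ^ 2) ^ n ∂μH := by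
  obtain ⟨V, hV⟩ := unitary_rot p q hpq w hw s
  simp_rw [← hV, mul_pow]
  rw [integral_const_mul]
  congr 1
  have := integral_mul_left_eq_self (μ := μH) (fun U : Matrix.unitaryGroup (Fin d) ℂ =>
    (‖(U : Matrix (Fin d) (Fin d) ℂ) p j‖ ^ 2) ^ n) V
  simpa only [mul_pow] using this

theorem cross_moment {d : ℕ} (μH : Measure (Matrix.unitaryGroup (Fin d) ℂ)) [μH.IsHaarMeasure]
    [IsProbabilityMeasure μH] (p q j : Fin d) (hpq : p ≠ q) (n : ℕ) :
    ∫ U, (‖(U : Matrix (Fin d) (Fin d) ℂ) p j‖ ^ 2) ^ (n + 1) ∂μH ≤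
      (n + 1) * ∫ U, (‖(U : Matrix (Fin d) (Fin d) ℂ) p j‖ ^ 2) ^ n *
        ‖(U : Matrix (Fin d) (Fin d) ℂ) q j‖ ^ 2 ∂μH := by
  obtain ⟨C, hC, h⟩ := four_aux n
  set c := ∫ U, (‖(U : Matrix (Fin d) (Fin d) ℂ) p j‖ ^ 2) ^ (n + 1) ∂μH with hc
  set X := ∫ U, (‖(U : Matrix (Fin d) (Fin d) ℂ) p j‖ ^ 2) ^ n *
        ‖(U : Matrix (Fin d) (Fin d) ℂ) q j‖ ^ 2 ∂μH with hX
  have hc0 : 0 ≤ c := integral_nonneg fun U => by positivity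
  have hsq1 : ∀ (U : Matrix.unitaryGroup (Fin d) ℂ) (i : Fin d),
      ‖(U : Matrix (Fin d) (Fin d) ℂ) i j‖ ^ 2 ≤ 1 := fun U i => pow_le_one₀ (norm_nonneg _) (entry_le U i j)
  have i1 : Integrable (fun U : Matrix.unitaryGroup (Fin d) ℂ => (‖(U : Matrix (Fin d) (Fin d) ℂ) p j‖ ^ 2) ^ (n + 1)) μH := by
    refine integrable_bdd _ _ (((cont_entry p j).norm.pow 2).pow _) 1 fun U => ?_
    rw [abs_of_nonneg (by positivity)]
    exact pow_le_one₀ (by positivity) (hsq1 U p)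
  have i2 : Integrable (fun U : Matrix.unitaryGroup (Fin d) ℂ => (‖(U : Matrix (Fin d) (Fin d) ℂ) p j‖ ^ 2) ^ n *
        ‖(U : Matrix (Fin d) (Fin d) ℂ) q j‖ ^ 2) μH := by
    refine integrable_bdd _ _ ((((cont_entry p j).norm.pow 2).pow _).mul ((cont_entry q j).norm.pow 2)) 1 fun U => ?_
    rw [abs_of_nonneg (by positivity)]
    exact mul_le_one₀ (pow_le_one₀ (by positivity) (hsq1 U p)) (by positivity) (hsq1 U q)
  have i3 : ∀ (w : ℂ), ‖w‖ = 1 → ∀ s : ℝ, 0 ≤ s → s ≤ 1 → Integrable (fun U : Matrix.unitaryGroup (Fin d) ℂ =>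
      (‖(U : Matrix (Fin d) (Fin d) ℂ) p j + s * w * (U : Matrix (Fin d) (Fin d) ℂ) q j‖ ^ 2) ^ (n + 1)) μH := by
    intro w hw s hs hs1
    refine integrable_bdd _ _ ((((cont_entry p j).add (continuous_const.mul (cont_entry q j))).norm.pow 2).pow _)
      ((2 ^ 2) ^ (n + 1)) fun U => ?_
    rw [abs_of_nonneg (by positivity)]
    gcongr
    refine (norm_add_le _ _).trans ?_
    rw [norm_mul, norm_mul, hw, Complex.norm_real, Real.norm_eq_abs, abs_of_nonneg hs]
    have e1 := entry_le U p j
    have e2 := mul_le_mul hs1 (entry_le U q j) (norm_nonneg _) zero_le_one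
    rw [mul_one]
    linarith
  have main : ∀ s : ℝ, 0 < s → s ≤ 1 → 4 * (n + 1) * c ≤ 4 * (n + 1) ^ 2 * X + C * s := by
    intro s hs hs1
    have w1 : ‖(1 : ℂ)‖ = 1 := by simp
    have w2 : ‖(-1 : ℂ)‖ = 1 := by simp
    have w3 : ‖Complex.I‖ = 1 := by simp
    have w4 : ‖-Complex.I‖ = 1 := by simp
    have j1 := i3 _ w1 s hs.le hs1
    have j2 := i3 _ w2 s hs.le hs1
    have j3 := i3 _ w3 s hs.le hs1
    have j4 := i3 _ w4 s hs.le hs1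
    have hm := integral_mono (((j1.add j2).add j3).add j4)
      (((i1.const_mul 4).add (i2.const_mul (4 * (n + 1) ^ 2 * s ^ 2))).add (integrable_const (C * s ^ 3)))
      (fun U => h _ _ s (entry_le U p j) (entry_le U q j) hs.le hs1)
    rw [integral_add' ((j1.add j2).add j3) j4, integral_add' (j1.add j2) j3, integral_add' j1 j2,
      haar_rot μH p q j hpq _ w1, haar_rot μH p q j hpq _ w2, haar_rot μH p q j hpq _ w3,
      haar_rot μH p q j hpq _ w4,
      integral_add' ((i1.const_mul 4).add (i2.const_mul _)) (integrable_const _),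
      integral_add' (i1.const_mul 4) (i2.const_mul _), integral_const_mul, integral_const_mul,
      integral_const, ← hc, ← hX] at hm
    simp only [probReal_univ, one_smul] at hm
    have hb : 1 + ((n + 1 : ℕ) : ℝ) * s ^ 2 ≤ (1 + s ^ 2) ^ (n + 1) :=
      one_add_mul_le_pow (by nlinarith [sq_nonneg s]) _
    have hb2 := mul_le_mul_of_nonneg_right hb hc0
    push_cast at hb2
    have : (4 * (n + 1) * c) * s ^ 2 ≤ (4 * (n + 1) ^ 2 * X + C * s) * s ^ 2 := by nlinarith
    exact le_of_mul_le_mul_right this (by positivity)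
  have lim : 4 * (n + 1) * c ≤ 4 * (n + 1) ^ 2 * X := by
    apply le_of_forall_pos_le_add
    intro δ hδ
    have hpos : 0 < min 1 (δ / (C + 1)) := by positivity
    refine (main _ hpos (min_le_left _ _)).trans ?_
    gcongr
    calc C * min 1 (δ / (C + 1)) ≤ (C + 1) * (δ / (C + 1)) := by
          gcongr
          · linarith
          · exact min_le_right _ _
      _ = δ := by field_simp
  have hn : (0 : ℝ) < 4 * (n + 1) := by positivity
  refine le_of_mul_le_mul_left ?_ hn
  calc _ ≤ _ := lim
    _ = _ := by ring

theorem haar_moment {d : ℕ} (μH : Measure (Matrix.unitaryGroup (Fin d) ℂ)) [μH.IsHaarMeasure]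
    [IsProbabilityMeasure μH] (p j : Fin d) (n : ℕ) :
    (d : ℝ) ^ n * ∫ U, (‖(U : Matrix (Fin d) (Fin d) ℂ) p j‖ ^ 2) ^ n ∂μH ≤ n.factorial := by
  induction n with
  | zero => simp
  | succ n ih =>
    set c := ∫ U, (‖(U : Matrix (Fin d) (Fin d) ℂ) p j‖ ^ 2) ^ (n + 1) ∂μH with hc
    set b := ∫ U, (‖(U : Matrix (Fin d) (Fin d) ℂ) p j‖ ^ 2) ^ n ∂μH with hb
    have hc0 : 0 ≤ c := integral_nonneg fun U => by positivity
    have hsq1 : ∀ (U : Matrix.unitaryGroup (Fin d) ℂ) (i : Fin d),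
      ‖(U : Matrix (Fin d) (Fin d) ℂ) i j‖ ^ 2 ≤ 1 := fun U i => pow_le_one₀ (norm_nonneg _) (entry_le U i j)
    have i2 : ∀ q, Integrable (fun U : Matrix.unitaryGroup (Fin d) ℂ => (‖(U : Matrix (Fin d) (Fin d) ℂ) p j‖ ^ 2) ^ n *
        ‖(U : Matrix (Fin d) (Fin d) ℂ) q j‖ ^ 2) μH := by
      intro q
      refine integrable_bdd _ _ ((((cont_entry p j).norm.pow 2).pow _).mul ((cont_entry q j).norm.pow 2)) 1 fun U => ?_
      rw [abs_of_nonneg (by positivity)]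
      exact mul_le_one₀ (pow_le_one₀ (by positivity) (hsq1 U p)) (by positivity) (hsq1 U q)
    have hcol : ∀ U : Matrix.unitaryGroup (Fin d) ℂ, ∑ q, ‖(U : Matrix (Fin d) (Fin d) ℂ) q j‖ ^ 2 = 1 := by
      intro U
      have h := congrFun (congrFun (Matrix.mem_unitaryGroup_iff'.1 U.2) j) j
      simp only [Matrix.mul_apply, Matrix.star_apply, Matrix.one_apply_eq, RCLike.star_def,
        Complex.conj_mul'] at h
      exact_mod_cast h
    have hsum : b = ∑ q, ∫ U, (‖(U : Matrix (Fin d) (Fin d) ℂ) p j‖ ^ 2) ^ n *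
        ‖(U : Matrix (Fin d) (Fin d) ℂ) q j‖ ^ 2 ∂μH := by
      rw [← integral_finsetSum _ (fun q _ => i2 q), hb]
      congr 1; ext U
      rw [← Finset.mul_sum, hcol, mul_one]
    have hle : ∀ q, c ≤ (n + 1) * ∫ U, (‖(U : Matrix (Fin d) (Fin d) ℂ) p j‖ ^ 2) ^ n *
        ‖(U : Matrix (Fin d) (Fin d) ℂ) q j‖ ^ 2 ∂μH := by
      intro q
      by_cases hpq : p = q
      · subst hpq
        simp_rw [← pow_succ]
        rw [← hc]
        nlinarith [(Nat.cast_nonneg n : (0 : ℝ) ≤ n)]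
      · exact cross_moment μH p q j hpq n
    have hdc : (d : ℝ) * c ≤ (n + 1) * b := by
      rw [hsum, Finset.mul_sum]
      calc (d : ℝ) * c = ∑ _q : Fin d, c := by simp
        _ ≤ _ := Finset.sum_le_sum fun q _ => hle q
    rw [Nat.factorial_succ]
    push_cast
    calc (d : ℝ) ^ (n + 1) * c = d ^ n * (d * c) := by ring
      _ ≤ d ^ n * ((n + 1) * b) := by gcongr
      _ = (n + 1) * (d ^ n * b) := by ring
      _ ≤ _ := by gcongr

theorem entry_le_frob {α : Type*} [Fintype α] (M : Matrix α α ℂ) (x y : α) : ‖M x y‖ ≤ frobNorm M := by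
  unfold frobNorm
  apply Real.le_sqrt_of_sq_le
  calc ‖M x y‖ ^ 2 ≤ ∑ y, ‖M x y‖ ^ 2 :=
        Finset.single_le_sum (f := fun y => ‖M x y‖ ^ 2) (fun _ _ => by positivity) (Finset.mem_univ y)
    _ ≤ _ := Finset.single_le_sum (f := fun x => ∑ y, ‖M x y‖ ^ 2) (fun _ _ => by positivity) (Finset.mem_univ x)

theorem frob_single {α : Type*} [Fintype α] [DecidableEq α] (x : α) :
    frobNorm (Matrix.single x x (1 : ℂ)) = 1 := by
  unfold frobNorm
  rw [Finset.sum_eq_single x, Finset.sum_eq_single x]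
  · simp
  · intro b _ hb; simp [Matrix.single_apply, hb.symm]
  · simp
  · intro b _ hb; simp [Matrix.single_apply, hb.symm]
  · simp

theorem moment_entry (d t : ℕ) (ρ : Measure (Matrix.unitaryGroup (Fin d) ℂ)) (i j : Fin d) :
    momentSuper d t ρ (Matrix.single (fun _ => j) (fun _ => j) 1) (fun _ => i) (fun _ => i)
      = ((∫ U, (‖(U : Matrix (Fin d) (Fin d) ℂ) i j‖ ^ 2) ^ t ∂ρ : ℝ) : ℂ) := by
  unfold momentSuper
  rw [← integral_complex_ofReal]
  congr 1; ext U
  rw [Matrix.mul_apply, Finset.sum_eq_single (fun _ => j)]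
  · simp only [Matrix.mul_single_apply_same, Matrix.conjTranspose_apply, tensorPow, mul_one,
      Finset.prod_const, Finset.card_univ, Fintype.card_fin, star_pow, ← mul_pow, RCLike.star_def, Complex.mul_conj']
    push_cast; rfl
  · intro b _ hb
    rw [Matrix.mul_single_apply_of_ne _ _ _ _ _ hb, zero_mul]
  · simp

/-- If `μ` is an `ε`-approximate unitary `t`-design, then for every `ν ≥ 0`
the `μ`-probability that some entry satisfies `|U_{i,j}|² ≥ 2^{-ν}` (i.e. `C(U) ≤ ν`) is at
most `d²·2^{νt}·(d^{-t}·t! + d^{2t}·ε)`. -/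
theorem design_flatness_tail_bound (d t : ℕ) (hd : 1 ≤ d) (ht : 1 ≤ t) (ε : ℝ) (hε : 0 ≤ ε)
    (μ : Measure (Matrix.unitaryGroup (Fin d) ℂ)) [IsProbabilityMeasure μ]
    (μH : Measure (Matrix.unitaryGroup (Fin d) ℂ))
    [μH.IsHaarMeasure] [IsProbabilityMeasure μH]
    (hdesign : ∀ X : Matrix (Fin t → Fin d) (Fin t → Fin d) ℂ,
      frobNorm (momentSuper d t μ X - momentSuper d t μH X) ≤ ε * frobNorm X)
    (ν : ℝ) (hν : 0 ≤ ν) :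
    μ {U : Matrix.unitaryGroup (Fin d) ℂ |
        ∃ i j : Fin d, (2 : ℝ) ^ (-ν) ≤ ‖(U : Matrix (Fin d) (Fin d) ℂ) i j‖ ^ 2}
      ≤ ENNReal.ofReal
          ((d : ℝ) ^ 2 * (2 : ℝ) ^ (ν * t) *
            (((d : ℝ) ^ t)⁻¹ * (t.factorial : ℝ) + (d : ℝ) ^ (2 * t) * ε)) := by

  have hmom : ∀ i j : Fin d, ∫ U, (‖(U : Matrix (Fin d) (Fin d) ℂ) i j‖ ^ 2) ^ t ∂μ ≤
      ((d : ℝ) ^ t)⁻¹ * (t.factorial : ℝ) + (d : ℝ) ^ (2 * t) * ε := by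
    intro i j
    have h := (entry_le_frob _ (fun _ : Fin t => i) (fun _ : Fin t => i)).trans
      (hdesign (Matrix.single (fun _ : Fin t => j) (fun _ : Fin t => j) (1 : ℂ)))
    rw [frob_single, Matrix.sub_apply, moment_entry, moment_entry, ← Complex.ofReal_sub,
      Complex.norm_real, Real.norm_eq_abs, mul_one] at h
    have h1 := (abs_le.1 h).2
    have hd1 : (1 : ℝ) ≤ d := by exact_mod_cast hd
    have h2 : ∫ U, (‖(U : Matrix (Fin d) (Fin d) ℂ) i j‖ ^ 2) ^ t ∂μH ≤ ((d : ℝ) ^ t)⁻¹ * (t.factorial : ℝ) := by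
      rw [le_inv_mul_iff₀ (by positivity)]
      exact haar_moment μH i j t
    have h3 : ε ≤ (d : ℝ) ^ (2 * t) * ε := le_mul_of_one_le_left hε (one_le_pow₀ hd1)
    linarith
  set K := ((d : ℝ) ^ t)⁻¹ * (t.factorial : ℝ) + (d : ℝ) ^ (2 * t) * ε with hK
  have hK0 : 0 ≤ K := by positivity
  have hone : ∀ i j : Fin d, μ {U : Matrix.unitaryGroup (Fin d) ℂ |
      (2 : ℝ) ^ (-ν) ≤ ‖(U : Matrix (Fin d) (Fin d) ℂ) i j‖ ^ 2} ≤
      ENNReal.ofReal ((2 : ℝ) ^ (ν * t) * K) := by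
    intro i j
    have hint : Integrable (fun U : Matrix.unitaryGroup (Fin d) ℂ => (‖(U : Matrix (Fin d) (Fin d) ℂ) i j‖ ^ 2) ^ t) μ := by
      refine integrable_bdd _ _ (((cont_entry i j).norm.pow 2).pow _) 1 fun U => ?_
      rw [abs_of_nonneg (by positivity)]
      exact pow_le_one₀ (by positivity) (pow_le_one₀ (norm_nonneg _) (entry_le U i j))
    have hmk := mul_meas_ge_le_integral_of_nonneg (μ := μ)
      (Filter.Eventually.of_forall fun U : Matrix.unitaryGroup (Fin d) ℂ => by
        show (0 : ℝ) ≤ (‖(U : Matrix (Fin d) (Fin d) ℂ) i j‖ ^ 2) ^ t; positivity) hint (((2 : ℝ) ^ (-ν)) ^ t)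
    have hpe : (2 : ℝ) ^ (ν * t) * ((2 : ℝ) ^ (-ν)) ^ t = 1 := by
      rw [← Real.rpow_natCast ((2 : ℝ) ^ (-ν)), ← Real.rpow_mul (by norm_num), ← Real.rpow_add (by norm_num)]
      simp
    have hsub : {U : Matrix.unitaryGroup (Fin d) ℂ |
        (2 : ℝ) ^ (-ν) ≤ ‖(U : Matrix (Fin d) (Fin d) ℂ) i j‖ ^ 2} ⊆
        {U | ((2 : ℝ) ^ (-ν)) ^ t ≤ (‖(U : Matrix (Fin d) (Fin d) ℂ) i j‖ ^ 2) ^ t} := by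
      intro U hU
      have h0 : (0 : ℝ) ≤ (2 : ℝ) ^ (-ν) := by positivity
      rw [Set.mem_setOf_eq] at hU ⊢
      exact pow_le_pow_left₀ h0 hU t
    refine (measure_mono hsub).trans ?_
    rw [← ENNReal.ofReal_toReal (measure_ne_top μ _)]
    apply ENNReal.ofReal_le_ofReal
    have h2 : (0 : ℝ) ≤ (2 : ℝ) ^ (ν * t) := by positivity
    have := mul_le_mul_of_nonneg_left (hmk.trans (hmom i j)) h2
    rw [← mul_assoc, hpe, one_mul] at this
    exact this
  have hset : {U : Matrix.unitaryGroup (Fin d) ℂ |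
        ∃ i j : Fin d, (2 : ℝ) ^ (-ν) ≤ ‖(U : Matrix (Fin d) (Fin d) ℂ) i j‖ ^ 2}
      = ⋃ i : Fin d, ⋃ j : Fin d, {U : Matrix.unitaryGroup (Fin d) ℂ |
        (2 : ℝ) ^ (-ν) ≤ ‖(U : Matrix (Fin d) (Fin d) ℂ) i j‖ ^ 2} := by
    ext U; simp
  rw [hset]
  refine (measure_iUnion_fintype_le _ _).trans ?_
  calc _ ≤ ∑ _i : Fin d, ∑ _j : Fin d, ENNReal.ofReal ((2 : ℝ) ^ (ν * t) * K) :=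
        Finset.sum_le_sum fun i _ => (measure_iUnion_fintype_le _ _).trans
          (Finset.sum_le_sum fun j _ => hone i j)
    _ = _ := by
      simp only [Finset.sum_const, Finset.card_univ, Fintype.card_fin, nsmul_eq_mul]
      rw [← ENNReal.ofReal_natCast, ← ENNReal.ofReal_mul (by positivity),
        ← ENNReal.ofReal_mul (by positivity)]
      congr 1; ring
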